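/- arXiv:2103.01471 — 2 statements merged into one kernel-verified Lean document; each statement's English description precedes it below -/
import Mathlib

section
/- Let G be a graph on a finite vertex set U with |U| = m, and let x be a natural number with 1 ≤ x ≤ ⌊m/3⌋. If G has no cut S with x ≤ |S| ≤ m − x, then the largest connected component of G has more than m − x vertices. -/
open Finset
open scoped Classical

noncomputable section

/-- A *cut* of a graph `G`: a nonempty proper subset of the vertex set such
that no edge of `G` joins a vertex of `S` to a vertex outside `S`. -/
def IsCut {V : Type*} [Fintype V] (G : SimpleGraph V) (S : Finset V) : Prop :=
  S.Nonempty ∧ S ≠ univ ∧ ∀ u ∈ S, ∀ v ∉ S, ¬ G.Adj u v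

/-- The number of vertices of a largest connected component. -/
def maxCompCard {V : Type*} [Fintype V] (G : SimpleGraph V) : ℕ :=
  univ.sup fun v => Nat.card {u | G.Reachable u v}

/-- **Lemma 4.1.** If a graph on `m` vertices has no cut `S` with
`x ≤ |S| ≤ m - x`, where `1 ≤ x ≤ ⌊m/3⌋`, then its largest connected component
has more than `m - x` vertices. -/
theorem giant_component_of_no_middle_cut
    {V : Type*} [Fintype V] (G : SimpleGraph V) (m x : ℕ)
    (hm : Fintype.card V = m) (hx1 : 1 ≤ x) (hx2 : x ≤ m / 3)
    (hcut : ∀ S : Finset V, x ≤ S.card → S.card ≤ m - x → ¬ IsCut G S) :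
    m - x < maxCompCard G := by
  by_contra hlt
  push Not at hlt
  have hx3 : 3 * x ≤ m := by omega
  -- closed sets of size at most m - x have size below x
  have key : ∀ S : Finset V, (∀ u ∈ S, ∀ v ∉ S, ¬ G.Adj u v) → S.card ≤ m - x → S.card < x := by
    intro S hS hc
    by_contra h
    push Not at h
    refine hcut S h hc ⟨?_, ?_, hS⟩
    · rw [← Finset.card_pos]; omega
    · rintro rfl
      rw [Finset.card_univ] at hc
      omega
  let F : Finset (Finset V) := univ.filter fun S =>
    (∀ u ∈ S, ∀ v ∉ S, ¬ G.Adj u v) ∧ S.card ≤ m - x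
  have hF : F.Nonempty := ⟨∅, by simp [F]⟩
  obtain ⟨S, hSF, hmax⟩ := Finset.exists_max_image F Finset.card hF
  have hS := (Finset.mem_filter.mp hSF).2
  have hSx := key S hS.1 hS.2
  obtain ⟨w, hw⟩ : ∃ w, w ∉ S := by
    by_contra h
    push Not at h
    have : S = univ := by ext a; simp [h a]
    rw [this, Finset.card_univ] at hSx
    omega
  let C : Finset V := univ.filter fun u => G.Reachable u w
  have hCclosed : ∀ u ∈ C, ∀ v ∉ C, ¬ G.Adj u v := by
    intro u hu v hv hadj
    simp only [C, Finset.mem_filter, Finset.mem_univ, true_and] at hu hv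
    exact hv (hadj.symm.reachable.trans hu)
  have hCcard : C.card ≤ m - x := by
    refine le_trans ?_ hlt
    have h1 : Nat.card {u | G.Reachable u w} ≤ maxCompCard G :=
      Finset.le_sup (f := fun v => Nat.card {u | G.Reachable u v}) (Finset.mem_univ w)
    refine le_trans (le_of_eq ?_) h1
    rw [Nat.card_eq_fintype_card, Fintype.card_subtype]
    simp [C]
  have hCx := key C hCclosed hCcard
  have hU : S ∪ C ∈ F := by
    refine Finset.mem_filter.mpr ⟨Finset.mem_univ _, ?_, ?_⟩
    · intro u hu v hv hadj
      rw [Finset.mem_union, not_or] at hv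
      rcases Finset.mem_union.mp hu with h | h
      · exact hS.1 u h v hv.1 hadj
      · exact hCclosed u h v hv.2 hadj
    · have := Finset.card_union_le S C
      omega
  have hle := hmax _ hU
  have hss : S ⊂ S ∪ C := by
    refine Finset.ssubset_iff_subset_ne.mpr ⟨Finset.subset_union_left, ?_⟩
    intro h
    apply hw
    rw [h]
    exact Finset.mem_union_right _ (by simp [C])
  have := Finset.card_lt_card hss
  omega
end
end

section
/- Let α ∈ (0,1), let (c_n) be a sequence of positive reals with c_n → c for some c > 1, and for n ≥ 2 set K_n = c_n · log n / (1 − α − log α). Define a_n = (1 − α) · e · n · exp( K_n · log(α + 1/log n) − K_n · (1 − α − 1/log n) ). Then a_n → 0 as n → ∞. -/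
open Filter

/-- Convergence of the sequence `a_n` in the proof of Theorem 3.1: with
`K_n = c_n · log n / (1 - α - log α)` and `c_n → c > 1`,
`a_n = (1-α) · e · n · exp(K_n · log(α + 1/log n) - K_n · (1 - α - 1/log n)) → 0`. -/
theorem a_n_tendsto_zero
    (α : ℝ) (hα : α ∈ Set.Ioo (0 : ℝ) 1)
    (c : ℝ) (hc : 1 < c)
    (cseq : ℕ → ℝ) (hcpos : ∀ n, 0 < cseq n)
    (hcseq : Tendsto cseq atTop (nhds c))
    (K : ℕ → ℝ)
    (hK : ∀ n : ℕ, 2 ≤ n → K n = cseq n * Real.log n / (1 - α - Real.log α)) :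
    Tendsto
      (fun n : ℕ => (1 - α) * Real.exp 1 * n *
        Real.exp (K n * Real.log (α + 1 / Real.log n)
          - K n * (1 - α - 1 / Real.log n)))
      atTop (nhds 0) := by
  obtain ⟨h0, h1⟩ := hα
  have hlog : Real.log α < 0 := Real.log_neg h0 h1
  have hD : 0 < 1 - α - Real.log α := by linarith
  have hL : Tendsto (fun n : ℕ => Real.log (n : ℝ)) atTop atTop :=
    Real.tendsto_log_atTop.comp tendsto_natCast_atTop_atTop
  have hinv : Tendsto (fun n : ℕ => 1 / Real.log (n : ℝ)) atTop (nhds 0) := by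
    simp only [one_div]
    exact tendsto_inv_atTop_zero.comp hL
  have hlg : Tendsto (fun n : ℕ => Real.log (α + 1 / Real.log (n : ℝ))) atTop
      (nhds (Real.log (α + 0))) :=
    (tendsto_const_nhds.add hinv).log (by simpa using h0.ne')
  have hin : Tendsto (fun n : ℕ => 1 + cseq n / (1 - α - Real.log α) *
      (Real.log (α + 1 / Real.log (n : ℝ)) - (1 - α - 1 / Real.log (n : ℝ)))) atTop
      (nhds (1 + c / (1 - α - Real.log α) * (Real.log (α + 0) - (1 - α - 0)))) :=
    tendsto_const_nhds.add ((hcseq.div_const _).mul (hlg.sub (tendsto_const_nhds.sub hinv)))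
  have hlim : 1 + c / (1 - α - Real.log α) * (Real.log (α + 0) - (1 - α - 0)) = 1 - c := by
    rw [add_zero, sub_zero]
    field_simp
    ring
  rw [hlim] at hin
  have hbot := hL.atTop_mul_neg (show 1 - c < 0 by linarith) hin
  have hexp := (Real.tendsto_exp_atBot.comp hbot).const_mul ((1 - α) * Real.exp 1)
  rw [mul_zero] at hexp
  refine hexp.congr' ?_
  filter_upwards [eventually_ge_atTop 2] with n hn
  have hn0 : (0 : ℝ) < n := by exact_mod_cast (by omega : 0 < n)
  rw [hK n hn, mul_assoc _ (n : ℝ)]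
  congr 1
  simp only [Function.comp]
  conv_rhs => rw [← Real.exp_log hn0, ← Real.exp_add, Real.exp_log hn0]
  congr 1
  ring
end
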